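/- arXiv:2602.20457 — 2 statements merged into one kernel-verified Lean document; each statement's English description precedes it below -/
import Mathlib

section
/- Let X and Y be finite nonempty types, μ : X → [0,1] with Σ_x μ(x) = 1, ψ : X × Y → ℝ^d with ‖ψ(x,y)‖ ≤ B_ψ, θ_ref ∈ ℝ^d, Θ ⊆ ℝ^d nonempty closed convex and bounded with D := sup_{θ∈Θ} ‖θ − θ_ref‖ < ∞, and ε > 0. For θ ∈ ℝ^d define π_θ(y|x) := exp(⟪θ, ψ(x,y)⟫)/Σ_{y'} exp(⟪θ, ψ(x,y')⟫), s_θ(x,y₁,y₂) := ⟪θ − θ_ref, ψ(x,y₁) − ψ(x,y₂)⟫, and the smoothed penalty R_ε(θ) := Σ_{x,y₁,y₂} μ(x)·π_θ(y₁|x)·π_θ(y₂|x)·sqrt(s_θ(x,y₁,y₂)² + ε²). Then R_ε is twice continuously differentiable, and for every θ ∈ Θ the Hessian satisfies ∇²R_ε(θ) ⪰ −(16B_ψ² + 4D·B_ψ³ + 2B_ψ²·ε)·I. -/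
open scoped RealInnerProductSpace BigOperators

/-- The log-linear (softmax) policy `π_θ(y|x) = exp⟪θ, ψ(x,y)⟫ / Σ_{y'} exp⟪θ, ψ(x,y')⟫`. -/
noncomputable def softmaxPolicy {n : ℕ} {X Y : Type*} [Fintype Y]
    (ψ : X × Y → EuclideanSpace ℝ (Fin n)) (θ : EuclideanSpace ℝ (Fin n)) (x : X) (y : Y) : ℝ :=
  Real.exp ⟪θ, ψ (x, y)⟫ / ∑ y' : Y, Real.exp ⟪θ, ψ (x, y')⟫

/-- The smoothed robust penalty
`R_ε(θ) = Σ_{x,y₁,y₂} μ(x) π_θ(y₁|x) π_θ(y₂|x) √(⟪θ−θ_ref, ψ(x,y₁)−ψ(x,y₂)⟫² + ε²)`. -/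
noncomputable def Rsmooth {n : ℕ} {X Y : Type*} [Fintype X] [Fintype Y] (μ : X → ℝ)
    (ψ : X × Y → EuclideanSpace ℝ (Fin n)) (θref : EuclideanSpace ℝ (Fin n)) (ε : ℝ)
    (θ : EuclideanSpace ℝ (Fin n)) : ℝ :=
  ∑ x : X, ∑ y₁ : Y, ∑ y₂ : Y,
    μ x * softmaxPolicy ψ θ x y₁ * softmaxPolicy ψ θ x y₂ *
      Real.sqrt (⟪θ - θref, ψ (x, y₁) - ψ (x, y₂)⟫ ^ 2 + ε ^ 2)

/-- The second derivative of a `C²` function in direction `v` can be computed along the line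
`t ↦ θ + t • v`. -/
lemma iteratedFDeriv_two_eq_of_hasDerivAt_line {E : Type*} [NormedAddCommGroup E]
    [NormedSpace ℝ E] {F : E → ℝ} (hF : ContDiff ℝ 2 F) (θ v : E) (h : ℝ → ℝ) (c : ℝ)
    (h₁ : ∀ t, HasDerivAt (fun t : ℝ => F (θ + t • v)) (h t) t) (h₂ : HasDerivAt h c 0) :
    iteratedFDeriv ℝ 2 F θ ![v, v] = c := by
  have hline : ∀ t : ℝ, HasDerivAt (fun t : ℝ => θ + t • v) v t := fun t => by
    simpa using ((hasDerivAt_id t).smul_const v).const_add θ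
  have hF' : Differentiable ℝ F := hF.differentiable (by norm_num)
  have hF'' : Differentiable ℝ (fderiv ℝ F) :=
    (hF.fderiv_right (m := 1) (by norm_num)).differentiable (by norm_num)
  have e : h = fun t => fderiv ℝ F (θ + t • v) v := by
    funext t
    exact (h₁ t).unique ((hF' _).hasFDerivAt.comp_hasDerivAt t (hline t))
  have h₃ : HasDerivAt h (fderiv ℝ (fderiv ℝ F) (θ + (0 : ℝ) • v) v v) 0 := by
    rw [e]
    have := (hF'' (θ + (0 : ℝ) • v)).hasFDerivAt.comp_hasDerivAt (0 : ℝ) (hline 0)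
    simpa using this.clm_apply (hasDerivAt_const (0 : ℝ) v)
  rw [iteratedFDeriv_two_apply]
  simpa using h₃.unique h₂

section Softmax

variable {n : ℕ} {X Y : Type*} [Fintype Y] [Nonempty Y]
  (ψ : X × Y → EuclideanSpace ℝ (Fin n)) (θ : EuclideanSpace ℝ (Fin n)) (x : X)

lemma softmaxPolicy_sum_exp_pos : 0 < ∑ y' : Y, Real.exp ⟪θ, ψ (x, y')⟫ :=
  Finset.sum_pos (fun _ _ => Real.exp_pos _) Finset.univ_nonempty

lemma softmaxPolicy_nonneg (y : Y) : 0 ≤ softmaxPolicy ψ θ x y :=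
  div_nonneg (Real.exp_pos _).le (softmaxPolicy_sum_exp_pos ψ θ x).le

lemma sum_softmaxPolicy : ∑ y : Y, softmaxPolicy ψ θ x y = 1 := by
  unfold softmaxPolicy
  rw [← Finset.sum_div, div_self (softmaxPolicy_sum_exp_pos ψ θ x).ne']

lemma contDiff_softmaxPolicy (y : Y) {k : WithTop ℕ∞} :
    ContDiff ℝ k (fun θ => softmaxPolicy ψ θ x y) := by
  unfold softmaxPolicy
  refine ContDiff.div ?_ ?_ fun θ => (softmaxPolicy_sum_exp_pos ψ θ x).ne'
  · exact (contDiff_id.inner ℝ contDiff_const).exp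
  · exact ContDiff.sum fun y' _ => (contDiff_id.inner ℝ contDiff_const).exp

/-- The mean of the directional features `⟪v, ψ(x,·)⟫` under the softmax policy. -/
noncomputable def softmaxMean (v : EuclideanSpace ℝ (Fin n)) : ℝ :=
  ∑ y : Y, softmaxPolicy ψ θ x y * ⟪v, ψ (x, y)⟫

/-- The variance of the directional features `⟪v, ψ(x,·)⟫` under the softmax policy. -/
noncomputable def softmaxVar (v : EuclideanSpace ℝ (Fin n)) : ℝ :=
  ∑ y : Y, softmaxPolicy ψ θ x y * (⟪v, ψ (x, y)⟫ - softmaxMean ψ θ x v) * ⟪v, ψ (x, y)⟫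

lemma hasDerivAt_softmaxPolicy_line (v : EuclideanSpace ℝ (Fin n)) (y : Y) (t : ℝ) :
    HasDerivAt (fun t : ℝ => softmaxPolicy ψ (θ + t • v) x y)
      (softmaxPolicy ψ (θ + t • v) x y *
        (⟪v, ψ (x, y)⟫ - softmaxMean ψ (θ + t • v) x v)) t := by
  have he : ∀ y : Y, HasDerivAt (fun t : ℝ => Real.exp ⟪θ + t • v, ψ (x, y)⟫)
      (Real.exp ⟪θ + t • v, ψ (x, y)⟫ * ⟪v, ψ (x, y)⟫) t := fun y => by
    refine HasDerivAt.exp ?_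
    simp only [inner_add_left, real_inner_smul_left]
    simpa using ((hasDerivAt_id t).mul_const ⟪v, ψ (x, y)⟫).const_add ⟪θ, ψ (x, y)⟫
  have hZ := (softmaxPolicy_sum_exp_pos ψ (θ + t • v) x).ne'
  have h := (he y).fun_div (HasDerivAt.fun_sum fun y' (_ : y' ∈ Finset.univ) => he y') hZ
  unfold softmaxMean softmaxPolicy
  refine h.congr_deriv ?_
  simp only [div_mul_eq_mul_div, ← Finset.sum_div]
  field_simp

lemma hasDerivAt_softmaxMean_line (v : EuclideanSpace ℝ (Fin n)) (t : ℝ) :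
    HasDerivAt (fun t : ℝ => softmaxMean ψ (θ + t • v) x v) (softmaxVar ψ (θ + t • v) x v) t :=
  HasDerivAt.fun_sum fun y _ => (hasDerivAt_softmaxPolicy_line ψ θ x v y t).mul_const _

variable {ψ x} {v : EuclideanSpace ℝ (Fin n)} {C : ℝ}

lemma abs_softmaxMean_le (hC : ∀ y : Y, |⟪v, ψ (x, y)⟫| ≤ C) : |softmaxMean ψ θ x v| ≤ C := by
  calc |softmaxMean ψ θ x v| ≤ ∑ y : Y, |softmaxPolicy ψ θ x y * ⟪v, ψ (x, y)⟫| :=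
        Finset.abs_sum_le_sum_abs _ _
    _ ≤ ∑ y : Y, softmaxPolicy ψ θ x y * C := Finset.sum_le_sum fun y _ => by
        rw [abs_mul, abs_of_nonneg (softmaxPolicy_nonneg ψ θ x y)]
        exact mul_le_mul_of_nonneg_left (hC y) (softmaxPolicy_nonneg ψ θ x y)
    _ = C := by rw [← Finset.sum_mul, sum_softmaxPolicy, one_mul]

lemma softmaxVar_le (hC : ∀ y : Y, |⟪v, ψ (x, y)⟫| ≤ C) : softmaxVar ψ θ x v ≤ C ^ 2 := by
  have e : softmaxVar ψ θ x v =
      ∑ y : Y, softmaxPolicy ψ θ x y * ⟪v, ψ (x, y)⟫ ^ 2 - softmaxMean ψ θ x v ^ 2 := by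
    rw [pow_two (softmaxMean ψ θ x v)]
    nth_rewrite 2 [softmaxMean]
    rw [Finset.mul_sum, ← Finset.sum_sub_distrib]
    exact Finset.sum_congr rfl fun y _ => by ring
  have h : ∑ y : Y, softmaxPolicy ψ θ x y * ⟪v, ψ (x, y)⟫ ^ 2
      ≤ ∑ y : Y, softmaxPolicy ψ θ x y * C ^ 2 := Finset.sum_le_sum fun y _ =>
    mul_le_mul_of_nonneg_left (sq_le_sq.mpr ((hC y).trans (le_abs_self C)))
      (softmaxPolicy_nonneg ψ θ x y)
  rw [← Finset.sum_mul, sum_softmaxPolicy, one_mul] at h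
  nlinarith [sq_nonneg (softmaxMean ψ θ x v)]

end Softmax

lemma sqrt_sq_add_sq_pos {ε : ℝ} (hε : 0 < ε) (u : ℝ) : 0 < √(u ^ 2 + ε ^ 2) :=
  Real.sqrt_pos.mpr (by positivity)

lemma hasDerivAt_sqrt_sq_add_sq {ε : ℝ} (hε : 0 < ε) {s : ℝ → ℝ} {c t : ℝ}
    (hs : HasDerivAt s c t) :
    HasDerivAt (fun t => √(s t ^ 2 + ε ^ 2)) (s t / √(s t ^ 2 + ε ^ 2) * c) t := by
  refine (((hs.fun_pow 2).add_const (ε ^ 2)).sqrt (by positivity)).congr_deriv ?_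
  have := (sqrt_sq_add_sq_pos hε (s t)).ne'
  field_simp
  norm_num
  ring

lemma hasDerivAt_div_sqrt_sq_add_sq {ε : ℝ} (hε : 0 < ε) {s : ℝ → ℝ} {c t : ℝ}
    (hs : HasDerivAt s c t) :
    HasDerivAt (fun t => s t / √(s t ^ 2 + ε ^ 2)) (ε ^ 2 / √(s t ^ 2 + ε ^ 2) ^ 3 * c) t := by
  have h0 := (sqrt_sq_add_sq_pos hε (s t)).ne'
  refine (hs.fun_div (hasDerivAt_sqrt_sq_add_sq hε hs) h0).congr_deriv ?_
  have h2 : √(s t ^ 2 + ε ^ 2) ^ 2 = s t ^ 2 + ε ^ 2 := Real.sq_sqrt (by positivity)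
  field_simp
  rw [h2]
  ring

lemma abs_div_sqrt_sq_add_sq_le_one (u ε : ℝ) : |u / √(u ^ 2 + ε ^ 2)| ≤ 1 := by
  rw [abs_div, abs_of_nonneg (Real.sqrt_nonneg _)]
  exact div_le_one_of_le₀ (Real.abs_le_sqrt (by nlinarith [sq_nonneg ε])) (Real.sqrt_nonneg _)

lemma sqrt_sq_add_sq_le {ε : ℝ} (hε : 0 < ε) {u K : ℝ} (hu : |u| ≤ K) :
    √(u ^ 2 + ε ^ 2) ≤ K + ε := by
  have hK := (abs_nonneg u).trans hu
  refine Real.sqrt_le_iff.mpr ⟨by positivity, ?_⟩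
  nlinarith [sq_abs u, mul_nonneg hK hε.le, abs_nonneg u]

lemma contDiff_Rsmooth {n : ℕ} {X Y : Type*} [Fintype X] [Fintype Y] [Nonempty Y]
    (μ : X → ℝ) (ψ : X × Y → EuclideanSpace ℝ (Fin n)) (θref : EuclideanSpace ℝ (Fin n))
    {ε : ℝ} (hε : 0 < ε) {k : WithTop ℕ∞} : ContDiff ℝ k (Rsmooth μ ψ θref ε) := by
  unfold Rsmooth
  refine ContDiff.sum fun x _ => ContDiff.sum fun y₁ _ => ContDiff.sum fun y₂ _ => ?_
  refine ((contDiff_const.mul (contDiff_softmaxPolicy ψ x y₁)).mul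
    (contDiff_softmaxPolicy ψ x y₂)).mul (ContDiff.sqrt ?_ fun θ => by positivity)
  exact (((contDiff_id.sub contDiff_const).inner ℝ contDiff_const).pow 2).add contDiff_const

/-- First derivative of one summand of the penalty along a line, where `p`, `q` are the two
probabilities, `m` the mean, `s` the margin, and `a`, `b` the two directional features. -/
lemma hasDerivAt_penalty_term {ε : ℝ} (hε : 0 < ε) (w a b c : ℝ) {p q m s : ℝ → ℝ} {t : ℝ}
    (hp : HasDerivAt p (p t * (a - m t)) t) (hq : HasDerivAt q (q t * (b - m t)) t)
    (hs : HasDerivAt s c t) :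
    HasDerivAt (fun t => w * p t * q t * √(s t ^ 2 + ε ^ 2))
      (w * p t * q t * ((a + b - 2 * m t) * √(s t ^ 2 + ε ^ 2)
        + s t / √(s t ^ 2 + ε ^ 2) * c)) t := by
  refine (((hp.const_mul w).fun_mul hq).fun_mul
    (hasDerivAt_sqrt_sq_add_sq hε hs)).congr_deriv ?_
  ring

/-- Second derivative of one summand of the penalty along a line. -/
lemma hasDerivAt_deriv_penalty_term {ε : ℝ} (hε : 0 < ε) (w a b c V : ℝ) {p q m s : ℝ → ℝ}
    {t : ℝ} (hp : HasDerivAt p (p t * (a - m t)) t) (hq : HasDerivAt q (q t * (b - m t)) t)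
    (hm : HasDerivAt m V t) (hs : HasDerivAt s c t) :
    HasDerivAt (fun t => w * p t * q t * ((a + b - 2 * m t) * √(s t ^ 2 + ε ^ 2)
        + s t / √(s t ^ 2 + ε ^ 2) * c))
      (w * p t * q t * ((a + b - 2 * m t) ^ 2 * √(s t ^ 2 + ε ^ 2)
        + 2 * ((a + b - 2 * m t) * (s t / √(s t ^ 2 + ε ^ 2)) * c)
        - 2 * (V * √(s t ^ 2 + ε ^ 2))
        + ε ^ 2 / √(s t ^ 2 + ε ^ 2) ^ 3 * c ^ 2)) t := by
  refine (((hp.const_mul w).fun_mul hq).fun_mul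
    ((((hm.const_mul 2).const_sub (a + b)).fun_mul (hasDerivAt_sqrt_sq_add_sq hε hs)).fun_add
      ((hasDerivAt_div_sqrt_sq_add_sq hε hs).mul_const c))).congr_deriv ?_
  ring

lemma penalty_curvature_lower_bound {ε : ℝ} (hε : 0 < ε) {a b m V u C K : ℝ}
    (ha : |a| ≤ C) (hb : |b| ≤ C) (hm : |m| ≤ C) (hV : V ≤ C ^ 2) (hu : |u| ≤ K) :
    -(16 * C ^ 2 + 2 * C ^ 2 * (K + ε)) ≤
      (a + b - 2 * m) ^ 2 * √(u ^ 2 + ε ^ 2)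
        + 2 * ((a + b - 2 * m) * (u / √(u ^ 2 + ε ^ 2)) * (a - b))
        - 2 * (V * √(u ^ 2 + ε ^ 2))
        + ε ^ 2 / √(u ^ 2 + ε ^ 2) ^ 3 * (a - b) ^ 2 := by
  have h₁ : 0 ≤ (a + b - 2 * m) ^ 2 * √(u ^ 2 + ε ^ 2) := by positivity
  have h₂ : 0 ≤ ε ^ 2 / √(u ^ 2 + ε ^ 2) ^ 3 * (a - b) ^ 2 := by positivity
  have h₃ : V * √(u ^ 2 + ε ^ 2) ≤ C ^ 2 * (K + ε) :=
    (mul_le_mul_of_nonneg_right hV (Real.sqrt_nonneg _)).trans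
      (mul_le_mul_of_nonneg_left (sqrt_sq_add_sq_le hε hu) (sq_nonneg C))
  have hC := (abs_nonneg a).trans ha
  rw [abs_le] at ha hb hm
  have hg : |a + b - 2 * m| ≤ 4 * C := by rw [abs_le]; constructor <;> linarith
  have hc : |a - b| ≤ 2 * C := by rw [abs_le]; constructor <;> linarith
  have h₄ : |(a + b - 2 * m) * (u / √(u ^ 2 + ε ^ 2)) * (a - b)| ≤ 4 * C * 1 * (2 * C) := by
    rw [abs_mul, abs_mul]
    have := abs_div_sqrt_sq_add_sq_le_one u ε
    gcongr
  have h₅ := neg_le_of_abs_le h₄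
  nlinarith

/-- Step 4 of the proof of Theorem 4.7: `R_ε` is twice continuously
differentiable and its Hessian satisfies
`∇²R_ε(θ) ⪰ −(16B_ψ² + 4D B_ψ³ + 2B_ψ² ε)·I` for every `θ ∈ Θ`. -/
theorem stmt7 {n : ℕ} {X Y : Type*} [Fintype X] [Fintype Y] [Nonempty X] [Nonempty Y]
    (μ : X → ℝ) (hμ : ∀ x, μ x ∈ Set.Icc (0 : ℝ) 1) (hμsum : ∑ x, μ x = 1)
    (ψ : X × Y → EuclideanSpace ℝ (Fin n)) (Bψ : ℝ)
    (hB : ∀ x y, ‖ψ (x, y)‖ ≤ Bψ)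
    (θref : EuclideanSpace ℝ (Fin n)) (Θ : Set (EuclideanSpace ℝ (Fin n)))
    (hne : Θ.Nonempty) (hcl : IsClosed Θ) (hconv : Convex ℝ Θ)
    (hbdd : Bornology.IsBounded Θ) (D : ℝ)
    (hD : IsLUB ((fun θ => ‖θ - θref‖) '' Θ) D)
    (ε : ℝ) (hε : 0 < ε) :
    ContDiff ℝ 2 (Rsmooth μ ψ θref ε) ∧
    ∀ θ ∈ Θ, ∀ v : EuclideanSpace ℝ (Fin n),
      -((16 * Bψ ^ 2 + 4 * D * Bψ ^ 3 + 2 * Bψ ^ 2 * ε) * ‖v‖ ^ 2)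
        ≤ iteratedFDeriv ℝ 2 (Rsmooth μ ψ θref ε) θ ![v, v] := by
  have hR : ContDiff ℝ 2 (Rsmooth μ ψ θref ε) := contDiff_Rsmooth μ ψ θref hε
  refine ⟨hR, fun θ hθ v => ?_⟩
  have hB0 : 0 ≤ Bψ := (norm_nonneg _).trans (hB (Classical.arbitrary X) (Classical.arbitrary Y))
  have hDθ : ‖θ - θref‖ ≤ D := hD.1 ⟨θ, hθ, rfl⟩
  have hfeat : ∀ x y, |⟪v, ψ (x, y)⟫| ≤ Bψ * ‖v‖ := fun x y =>
    (abs_real_inner_le_norm _ _).trans <| by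
      rw [mul_comm]; exact mul_le_mul_of_nonneg_right (hB x y) (norm_nonneg v)
  have hmargin : ∀ x y₁ y₂, |⟪θ - θref, ψ (x, y₁) - ψ (x, y₂)⟫| ≤ D * (2 * Bψ) :=
    fun x y₁ y₂ => (abs_real_inner_le_norm _ _).trans <| by
      have h : ‖ψ (x, y₁) - ψ (x, y₂)‖ ≤ 2 * Bψ := by
        linarith [norm_sub_le (ψ (x, y₁)) (ψ (x, y₂)), hB x y₁, hB x y₂]
      exact mul_le_mul hDθ h (norm_nonneg _) ((norm_nonneg _).trans hDθ)
  have hs : ∀ x y₁ y₂ (t : ℝ),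
      HasDerivAt (fun t : ℝ => ⟪θ + t • v - θref, ψ (x, y₁) - ψ (x, y₂)⟫)
        (⟪v, ψ (x, y₁)⟫ - ⟪v, ψ (x, y₂)⟫) t := fun x y₁ y₂ t => by
    rw [← inner_sub_right]
    simp only [add_sub_right_comm θ _ θref, inner_add_left, real_inner_smul_left]
    simpa using ((hasDerivAt_id t).mul_const ⟪v, ψ (x, y₁) - ψ (x, y₂)⟫).const_add
      ⟪θ - θref, ψ (x, y₁) - ψ (x, y₂)⟫
  have hp := fun x y t => hasDerivAt_softmaxPolicy_line ψ θ x v y t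
  rw [iteratedFDeriv_two_eq_of_hasDerivAt_line hR θ v _ _
    (fun t => HasDerivAt.fun_sum fun x _ => HasDerivAt.fun_sum fun y₁ _ =>
      HasDerivAt.fun_sum fun y₂ _ =>
        hasDerivAt_penalty_term hε (μ x) ⟪v, ψ (x, y₁)⟫ ⟪v, ψ (x, y₂)⟫ _
          (p := fun t => softmaxPolicy ψ (θ + t • v) x y₁)
          (q := fun t => softmaxPolicy ψ (θ + t • v) x y₂)
          (m := fun t => softmaxMean ψ (θ + t • v) x v) (hp x y₁ t) (hp x y₂ t) (hs x y₁ y₂ t))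
    (HasDerivAt.fun_sum fun x _ => HasDerivAt.fun_sum fun y₁ _ =>
      HasDerivAt.fun_sum fun y₂ _ =>
        hasDerivAt_deriv_penalty_term hε (μ x) _ _ _ _
          (p := fun t => softmaxPolicy ψ (θ + t • v) x y₁)
          (q := fun t => softmaxPolicy ψ (θ + t • v) x y₂)
          (m := fun t => softmaxMean ψ (θ + t • v) x v) (hp x y₁ 0) (hp x y₂ 0)
          (hasDerivAt_softmaxMean_line ψ θ x v 0) (hs x y₁ y₂ 0))]
  simp only [zero_smul, add_zero]
  set κ := (16 * Bψ ^ 2 + 4 * D * Bψ ^ 3 + 2 * Bψ ^ 2 * ε) * ‖v‖ ^ 2 with hκ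
  have hsum : -κ = ∑ x, ∑ y₁, ∑ y₂,
      μ x * softmaxPolicy ψ θ x y₁ * softmaxPolicy ψ θ x y₂ * -κ := by
    simp only [← Finset.sum_mul, ← Finset.mul_sum, sum_softmaxPolicy, mul_one, hμsum, one_mul]
  rw [hsum]
  refine Finset.sum_le_sum fun x _ => Finset.sum_le_sum fun y₁ _ =>
    Finset.sum_le_sum fun y₂ _ => mul_le_mul_of_nonneg_left ?_ ?_
  · refine le_trans (le_of_eq ?_) (penalty_curvature_lower_bound hε (hfeat x y₁) (hfeat x y₂)
      (abs_softmaxMean_le θ (hfeat x)) (softmaxVar_le θ (hfeat x)) (hmargin x y₁ y₂))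
    rw [hκ]
    ring
  · exact mul_nonneg (mul_nonneg (hμ x).1 (softmaxPolicy_nonneg ψ θ x y₁))
      (softmaxPolicy_nonneg ψ θ x y₂)
end

section
/- Let Θ ⊆ ℝ^d be nonempty closed convex, F = f + I_Θ with f : ℝ^d → ℝ, F κ-weakly convex (κ > 0) and bounded below by F_inf > −∞. Fix λ ∈ (0, 1/κ), L_env := 1/(λ(1−κλ)), η > 0, T ∈ ℕ with T ≥ 1, and G_tot ≥ 0. Let θ_0 ∈ Θ be deterministic and let θ_1, …, θ_T and G_0, …, G_{T−1} be random vectors on a probability space such that for each t: θ_{t+1} = proj_Θ(θ_t − η·G_t) almost surely, the conditional expectation of G_t given θ_t lies in ∂F(θ_t) almost surely, and E[‖G_t‖² | θ_t] ≤ G_tot² almost surely. Then (1/T)·Σ_{t=0}^{T−1} E[‖∇F_λ(θ_t)‖²] ≤ (F_λ(θ_0) − F_inf)/(η(1−κλ)·T) + L_env·η·G_tot²/(2(1−κλ)). -/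
open scoped RealInnerProductSpace BigOperators
open MeasureTheory

/-- Subdifferential of the `κ`-weakly convex function `F = f + I_Θ`. -/
def wsubdiffOn {n : ℕ} (Θ : Set (EuclideanSpace ℝ (Fin n))) (κ : ℝ)
    (f : EuclideanSpace ℝ (Fin n) → ℝ) (x : EuclideanSpace ℝ (Fin n)) :
    Set (EuclideanSpace ℝ (Fin n)) :=
  {g | ∀ y ∈ Θ, f x + ⟪g, y - x⟫ - (κ / 2) * ‖y - x‖ ^ 2 ≤ f y}

/-- Moreau envelope of `F = f + I_Θ`: `F_λ(z) = inf_{u ∈ Θ} { f(u) + (1/(2λ))‖u−z‖² }`. -/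
noncomputable def envOn {n : ℕ} (Θ : Set (EuclideanSpace ℝ (Fin n)))
    (f : EuclideanSpace ℝ (Fin n) → ℝ) (lam : ℝ) (z : EuclideanSpace ℝ (Fin n)) : ℝ :=
  ⨅ u : Θ, (f u + (1 / (2 * lam)) * ‖(u : EuclideanSpace ℝ (Fin n)) - z‖ ^ 2)

section Deterministic

variable {E : Type*} [NormedAddCommGroup E] [InnerProductSpace ℝ E]

/-- Adding the proximal term `(c/2)‖u - z‖²` raises the modulus of strong convexity by `c`. -/
lemma StrongConvexOn.add_norm_sub_sq {s : Set E} {m : ℝ} {f : E → ℝ}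
    (hf : StrongConvexOn s m f) (c : ℝ) (z : E) :
    StrongConvexOn s (m + c) (fun u => f u + c / 2 * ‖u - z‖ ^ 2) := by
  rw [strongConvexOn_iff_convex] at hf ⊢
  have hlin : ConvexOn ℝ s (fun u => (-c • innerSL ℝ z : E →L[ℝ] ℝ) u) :=
    ((-c • innerSL ℝ z : E →L[ℝ] ℝ) : E →ₗ[ℝ] ℝ).convexOn hf.1
  refine ((hf.add hlin).add_const (c / 2 * ‖z‖ ^ 2)).congr fun u _ => ?_
  simp only [Pi.add_apply, smul_apply, innerSL_apply_apply, smul_eq_mul,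
    norm_sub_sq_real, real_inner_comm u z]
  ring

/-- A strongly convex function grows quadratically away from a minimizer. -/
lemma StrongConvexOn.add_le_of_isMinOn {s : Set E} {m : ℝ} {f : E → ℝ}
    (hf : StrongConvexOn s m f) {u y : E} (hu : u ∈ s) (hmin : IsMinOn f s u) (hy : y ∈ s) :
    f u + m / 2 * ‖y - u‖ ^ 2 ≤ f y := by
  have key : ∀ r ∈ Set.Ioo (0 : ℝ) 1, (1 - r) * (m / 2 * ‖y - u‖ ^ 2) ≤ f y - f u := by
    rintro r ⟨hr0, hr1⟩
    have h := hf.2 hy hu hr0.le (sub_nonneg.2 hr1.le) (by ring)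
    have h' : f u ≤ f (r • y + (1 - r) • u) :=
      hmin (hf.1 hy hu hr0.le (sub_nonneg.2 hr1.le) (by ring))
    simp only [smul_eq_mul] at h
    refine le_of_mul_le_mul_left ?_ hr0
    linarith
  have hlim : Filter.Tendsto (fun r : ℝ => (1 - r) * (m / 2 * ‖y - u‖ ^ 2))
      (nhdsWithin 0 (Set.Ioi 0)) (nhds (m / 2 * ‖y - u‖ ^ 2)) := by
    have : Continuous fun r : ℝ => (1 - r) * (m / 2 * ‖y - u‖ ^ 2) := by fun_prop
    simpa using (this.tendsto 0).mono_left nhdsWithin_le_nhds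
  have := le_of_tendsto hlim
    (Filter.eventually_of_mem (Ioo_mem_nhdsGT zero_lt_one) key)
  linarith

/-- Quadratic growth of the proximal objective of a weakly convex function. -/
lemma prox_quadratic_growth {s : Set E} {f : E → ℝ} {κ lam : ℝ}
    (hf : StrongConvexOn s (-κ) f) {prox : E → E}
    (hprox : ∀ z, prox z ∈ s ∧ IsMinOn (fun u => f u + (1 / (2 * lam)) * ‖u - z‖ ^ 2) s (prox z))
    (z : E) {y : E} (hy : y ∈ s) :
    f (prox z) + (1 / (2 * lam)) * ‖prox z - z‖ ^ 2 + (1 / lam - κ) / 2 * ‖y - prox z‖ ^ 2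
      ≤ f y + (1 / (2 * lam)) * ‖y - z‖ ^ 2 := by
  have h := hf.add_norm_sub_sq (1 / lam) z
  have hc : 1 / lam / 2 = 1 / (2 * lam) := by rw [div_div, mul_comm]
  rw [hc] at h
  have := h.add_le_of_isMinOn (hprox z).1 (hprox z).2 hy
  rwa [neg_add_eq_sub] at this

/-- The proximal map of a `κ`-weakly convex function is `1/(1 - κλ)`-Lipschitz. -/
lemma prox_lipschitz {s : Set E} {f : E → ℝ} {κ lam : ℝ} (hlam : 0 < lam) (hκlam : κ * lam < 1)
    (hf : StrongConvexOn s (-κ) f) {prox : E → E}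
    (hprox : ∀ z, prox z ∈ s ∧ IsMinOn (fun u => f u + (1 / (2 * lam)) * ‖u - z‖ ^ 2) s (prox z)) :
    LipschitzWith (1 / (1 - κ * lam)).toNNReal prox := by
  have hpos : 0 < 1 - κ * lam := by linarith
  refine LipschitzWith.of_dist_le_mul fun z z' => ?_
  rw [Real.coe_toNNReal _ (by positivity), dist_eq_norm, dist_eq_norm]
  have h1 := prox_quadratic_growth hf hprox z (hprox z').1
  have h2 := prox_quadratic_growth hf hprox z' (hprox z).1
  have hid : ‖prox z' - z‖ ^ 2 - ‖prox z - z‖ ^ 2 + ‖prox z - z'‖ ^ 2 - ‖prox z' - z'‖ ^ 2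
      = 2 * ⟪prox z - prox z', z - z'⟫ := by
    simp only [norm_sub_sq_real, inner_sub_left, inner_sub_right]
    ring
  have hcs := real_inner_le_norm (prox z - prox z') (z - z')
  rw [norm_sub_rev (prox z') (prox z)] at h1
  set a := ‖prox z - prox z'‖
  have h3 : (1 / lam - κ) * a ^ 2 ≤ 1 / (2 * lam) * (2 * ⟪prox z - prox z', z - z'⟫) := by
    rw [← hid]; linarith
  have h4 : (1 - κ * lam) * a ^ 2 ≤ a * ‖z - z'‖ := by
    calc (1 - κ * lam) * a ^ 2 = lam * ((1 / lam - κ) * a ^ 2) := by field_simp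
      _ ≤ lam * (1 / (2 * lam) * (2 * ⟪prox z - prox z', z - z'⟫)) := by gcongr
      _ = ⟪prox z - prox z', z - z'⟫ := by field_simp
      _ ≤ _ := hcs
  rw [one_div, inv_mul_eq_div, le_div_iff₀ hpos]
  rcases (norm_nonneg (prox z - prox z')).eq_or_lt with h0 | h0
  · change 0 = a at h0
    rw [← h0]; simp
  · refine le_of_mul_le_mul_left (?_ : a * _ ≤ a * _) h0
    nlinarith

/-- The Euclidean projection onto a convex set does not increase the distance to its points. -/
lemma norm_proj_sub_le {s : Set E} (hs : Convex ℝ s) {p z u : E} (hp : p ∈ s)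
    (hmin : ∀ v ∈ s, ‖p - z‖ ≤ ‖v - z‖) (hu : u ∈ s) : ‖p - u‖ ≤ ‖z - u‖ := by
  have hsc : StrongConvexOn s 2 (fun v => ‖v - z‖ ^ 2) := by
    have := (strongConvexOn_zero.2 (convexOn_const (0 : ℝ) hs)).add_norm_sub_sq 2 z
    simpa using this
  have h := hsc.add_le_of_isMinOn hp
    (fun v hv => pow_le_pow_left₀ (norm_nonneg _) (hmin v hv) 2) hu
  rw [norm_sub_rev p u, norm_sub_rev z u]
  refine le_of_sq_le_sq ?_ (norm_nonneg _)
  nlinarith [sq_nonneg ‖p - z‖]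

end Deterministic

section Envelope

variable {n : ℕ} {Θ : Set (EuclideanSpace ℝ (Fin n))} {f : EuclideanSpace ℝ (Fin n) → ℝ}
  {lam Finf : ℝ}

lemma bddBelow_range_envOn (hlam : 0 < lam) (hFinf : ∀ u ∈ Θ, Finf ≤ f u)
    (z : EuclideanSpace ℝ (Fin n)) :
    BddBelow (Set.range fun u : Θ =>
      f u + (1 / (2 * lam)) * ‖(u : EuclideanSpace ℝ (Fin n)) - z‖ ^ 2) := by
  refine ⟨Finf, ?_⟩
  rintro _ ⟨u, rfl⟩
  have := hFinf u u.2
  have : 0 ≤ (1 / (2 * lam)) * ‖(u : EuclideanSpace ℝ (Fin n)) - z‖ ^ 2 := by positivity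
  dsimp only
  linarith

lemma envOn_le (hlam : 0 < lam) (hFinf : ∀ u ∈ Θ, Finf ≤ f u) (z : EuclideanSpace ℝ (Fin n))
    {u : EuclideanSpace ℝ (Fin n)} (hu : u ∈ Θ) :
    envOn Θ f lam z ≤ f u + (1 / (2 * lam)) * ‖u - z‖ ^ 2 :=
  ciInf_le (bddBelow_range_envOn hlam hFinf z) ⟨u, hu⟩

lemma le_envOn (hne : Θ.Nonempty) (hlam : 0 < lam) (hFinf : ∀ u ∈ Θ, Finf ≤ f u)
    (z : EuclideanSpace ℝ (Fin n)) : Finf ≤ envOn Θ f lam z := by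
  have := hne.to_subtype
  refine le_ciInf fun u => ?_
  have := hFinf u u.2
  have : 0 ≤ (1 / (2 * lam)) * ‖(u : EuclideanSpace ℝ (Fin n)) - z‖ ^ 2 := by positivity
  linarith

lemma envOn_eq_of_isMinOn {z p : EuclideanSpace ℝ (Fin n)} (hp : p ∈ Θ)
    (hmin : IsMinOn (fun u => f u + (1 / (2 * lam)) * ‖u - z‖ ^ 2) Θ p) :
    envOn Θ f lam z = f p + (1 / (2 * lam)) * ‖p - z‖ ^ 2 := by
  have : Nonempty Θ := ⟨⟨p, hp⟩⟩
  refine le_antisymm (ciInf_le ?_ (⟨p, hp⟩ : Θ)) (le_ciInf fun u => hmin u.2)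
  refine ⟨f p + (1 / (2 * lam)) * ‖p - z‖ ^ 2, ?_⟩
  rintro _ ⟨u, rfl⟩
  exact hmin u.2

lemma measurable_envOn (hlam : 0 < lam) (hFinf : ∀ u ∈ Θ, Finf ≤ f u) :
    Measurable (envOn Θ f lam) := by
  refine UpperSemicontinuous.measurable ?_
  refine upperSemicontinuous_ciInf (bddBelow_range_envOn hlam hFinf) fun u => ?_
  exact Continuous.upperSemicontinuous (by fun_prop)

/-- One projected subgradient step changes the Moreau envelope by at most the linear term along
the proximal direction plus the squared step length. -/
lemma envOn_proj_step_le (hconv : Convex ℝ Θ) (hlam : 0 < lam) (hFinf : ∀ u ∈ Θ, Finf ≤ f u)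
    {p x g q : EuclideanSpace ℝ (Fin n)} (η : ℝ) (hp : p ∈ Θ)
    (hmin : IsMinOn (fun u => f u + (1 / (2 * lam)) * ‖u - x‖ ^ 2) Θ p)
    (hq : q ∈ Θ) (hqmin : ∀ v ∈ Θ, ‖q - (x - η • g)‖ ≤ ‖v - (x - η • g)‖) :
    envOn Θ f lam q ≤ envOn Θ f lam x + η / lam * ⟪p - x, g⟫ + η ^ 2 / (2 * lam) * ‖g‖ ^ 2 := by
  have h1 := envOn_le hlam hFinf q hp
  have h2 := norm_proj_sub_le hconv hq hqmin hp
  have h3 : ‖x - η • g - p‖ ^ 2 = ‖p - x‖ ^ 2 + 2 * η * ⟪p - x, g⟫ + η ^ 2 * ‖g‖ ^ 2 := by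
    rw [show x - η • g - p = -((p - x) + η • g) by abel, norm_neg, norm_add_sq_real,
      inner_smul_right, norm_smul, mul_pow, Real.norm_eq_abs, sq_abs]
    ring
  rw [envOn_eq_of_isMinOn hp hmin]
  calc envOn Θ f lam q ≤ f p + 1 / (2 * lam) * ‖p - q‖ ^ 2 := h1
    _ ≤ f p + 1 / (2 * lam) * ‖x - η • g - p‖ ^ 2 := by
      rw [norm_sub_rev p q]; gcongr
    _ = _ := by rw [h3]; field_simp; ring

/-- A weak subgradient at `x` makes an obtuse angle with the proximal direction `prox x - x`. -/
lemma inner_prox_sub_le {κ : ℝ} (hf : StrongConvexOn Θ (-κ) f)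
    {prox : EuclideanSpace ℝ (Fin n) → EuclideanSpace ℝ (Fin n)}
    (hprox : ∀ z, prox z ∈ Θ ∧
      IsMinOn (fun u => f u + (1 / (2 * lam)) * ‖u - z‖ ^ 2) Θ (prox z))
    {x g : EuclideanSpace ℝ (Fin n)} (hx : x ∈ Θ) (hg : g ∈ wsubdiffOn Θ κ f x) :
    ⟪prox x - x, g⟫ ≤ -(1 / lam - κ) * ‖x - prox x‖ ^ 2 := by
  have h1 := hg (prox x) (hprox x).1
  have h2 := prox_quadratic_growth hf hprox x hx
  have h3 : 1 / (2 * lam) = 1 / lam / 2 := by rw [div_div, mul_comm]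
  rw [real_inner_comm, norm_sub_rev (prox x)] at h1
  rw [sub_self, norm_zero, norm_sub_rev (prox x), h3] at h2
  linarith

end Envelope

section Stochastic

variable {Ω : Type*} {m m0 : MeasurableSpace Ω} {P : Measure Ω}

/-- Integrating against an `m`-measurable factor only sees the conditional expectation. -/
lemma integral_inner_condExp {E : Type*} [NormedAddCommGroup E] [InnerProductSpace ℝ E]
    [CompleteSpace E] [IsFiniteMeasure P] (hm : m ≤ m0) {a G : Ω → E}
    (ha : StronglyMeasurable[m] a) (hG : Integrable G P)
    (haG : Integrable (fun ω => ⟪a ω, G ω⟫) P) :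
    Integrable (fun ω => ⟪a ω, (P[G | m]) ω⟫) P ∧
      ∫ ω, ⟪a ω, (P[G | m]) ω⟫ ∂P = ∫ ω, ⟪a ω, G ω⟫ ∂P := by
  have h : P[fun ω => ⟪a ω, G ω⟫ | m] =ᵐ[P] fun ω => ⟪a ω, (P[G | m]) ω⟫ :=
    condExp_bilin_of_stronglyMeasurable_left (innerSL ℝ) ha haG hG
  exact ⟨integrable_condExp.congr h, by rw [← integral_congr_ae h, integral_condExp hm]⟩

end Stochastic

/-- Theorem 5.2, convergence rate of R-SCGD measured by the Moreau
envelope: under the projected stochastic subgradient recursion with conditionally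
unbiased subgradients and conditional second moment at most `G_tot²`,
`(1/T)·Σ_t E‖∇F_λ(θ_t)‖² ≤ (F_λ(θ₀) − F_inf)/(η(1−κλ)T) + L_env η G_tot²/(2(1−κλ))`,
where `∇F_λ(z) = (z − prox(z))/λ` and `L_env = 1/(λ(1−κλ))`. -/
theorem stmt15 {n : ℕ} (Θ : Set (EuclideanSpace ℝ (Fin n))) (hne : Θ.Nonempty)
    (hcl : IsClosed Θ) (hconv : Convex ℝ Θ)
    (f : EuclideanSpace ℝ (Fin n) → ℝ) (κ : ℝ) (hκ : 0 < κ)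
    (hwc : ConvexOn ℝ Θ (fun θ => f θ + (κ / 2) * ‖θ‖ ^ 2))
    (Finf : ℝ) (hFinf : ∀ u ∈ Θ, Finf ≤ f u)
    (lam : ℝ) (hlam : lam ∈ Set.Ioo 0 (1 / κ))
    (η : ℝ) (hη : 0 < η) (T : ℕ) (hT : 1 ≤ T) (Gtot : ℝ) (hGtot : 0 ≤ Gtot)
    (proj : EuclideanSpace ℝ (Fin n) → EuclideanSpace ℝ (Fin n))
    (hproj : ∀ z, proj z ∈ Θ ∧ ∀ u ∈ Θ, ‖proj z - z‖ ≤ ‖u - z‖)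
    (prox : EuclideanSpace ℝ (Fin n) → EuclideanSpace ℝ (Fin n))
    (hprox : ∀ z, prox z ∈ Θ ∧
      IsMinOn (fun u => f u + (1 / (2 * lam)) * ‖u - z‖ ^ 2) Θ (prox z))
    {Ω : Type*} [MeasurableSpace Ω] (P : Measure Ω) [IsProbabilityMeasure P]
    (θ : ℕ → Ω → EuclideanSpace ℝ (Fin n)) (G : ℕ → Ω → EuclideanSpace ℝ (Fin n))
    (θ0 : EuclideanSpace ℝ (Fin n)) (hθ0mem : θ0 ∈ Θ) (hθ0 : θ 0 = fun _ => θ0)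
    (hθmeas : ∀ t, Measurable (θ t))
    (hGint : ∀ t, Integrable (G t) P)
    (hG2int : ∀ t, Integrable (fun ω => ‖G t ω‖ ^ 2) P)
    (hupd : ∀ t < T, ∀ᵐ ω ∂P, θ (t + 1) ω = proj (θ t ω - η • G t ω))
    (hcond : ∀ t < T, ∀ᵐ ω ∂P,
      (P[G t | MeasurableSpace.comap (θ t) inferInstance]) ω
        ∈ wsubdiffOn Θ κ f (θ t ω))
    (hvar : ∀ t < T, ∀ᵐ ω ∂P,
      (P[(fun ω' => ‖G t ω'‖ ^ 2) | MeasurableSpace.comap (θ t) inferInstance]) ω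
        ≤ Gtot ^ 2) :
    (1 / (T : ℝ)) * ∑ t ∈ Finset.range T,
        ∫ ω, ‖(1 / lam) • (θ t ω - prox (θ t ω))‖ ^ 2 ∂P
      ≤ (envOn Θ f lam θ0 - Finf) / (η * (1 - κ * lam) * T)
        + (1 / (lam * (1 - κ * lam))) * η * Gtot ^ 2 / (2 * (1 - κ * lam)) := by
  obtain ⟨hlam0, hlam1⟩ := hlam
  have hκlam : κ * lam < 1 := by rw [lt_div_iff₀ hκ] at hlam1; linarith
  have hpos : 0 < 1 - κ * lam := by linarith
  have hsc : StrongConvexOn Θ (-κ) f := by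
    rw [strongConvexOn_iff_convex]
    refine hwc.congr fun u _ => ?_
    ring
  have hlip := prox_lipschitz hlam0 hκlam hsc hprox
  have hproxm : Measurable prox := hlip.continuous.measurable
  have hmem : ∀ t ≤ T, ∀ᵐ ω ∂P, θ t ω ∈ Θ := by
    intro t ht
    cases t with
    | zero => simp [hθ0, hθ0mem]
    | succ t =>
      filter_upwards [hupd t ht] with ω hω
      rw [hω]
      exact (hproj _).1
  have hGL2 : ∀ t, MemLp (G t) 2 P := fun t =>
    (memLp_two_iff_integrable_sq_norm (hGint t).aestronglyMeasurable).2 (hG2int t)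
  have hθL2 : ∀ t ≤ T, MemLp (θ t) 2 P := by
    intro t
    induction t with
    | zero => intro _; rw [hθ0]; exact memLp_const _
    | succ t ih =>
      intro ht
      have h1 : MemLp (fun ω => θ t ω - η • G t ω - θ0) 2 P :=
        ((ih (by omega)).sub ((hGL2 t).const_smul η)).sub (memLp_const θ0)
      have h2 : MemLp (fun ω => θ (t + 1) ω - θ0) 2 P := by
        refine h1.mono ((hθmeas _).sub_const _).aestronglyMeasurable ?_
        filter_upwards [hupd t ht] with ω hω
        rw [hω]
        exact norm_proj_sub_le hconv (hproj _).1 (hproj _).2 hθ0mem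
      exact (h2.add (memLp_const θ0)).ae_eq (Filter.Eventually.of_forall fun ω => by simp)
  have hdL2 : ∀ t ≤ T, MemLp (fun ω => prox (θ t ω) - θ t ω) 2 P := by
    intro t ht
    have h1 : MemLp (fun ω => prox (θ t ω) - prox θ0) 2 P := by
      refine ((hθL2 t ht).sub (memLp_const θ0)).of_le_mul
        (c := (1 / (1 - κ * lam)).toNNReal)
        ((hproxm.comp (hθmeas t)).sub_const _).aestronglyMeasurable
        (Filter.Eventually.of_forall fun ω => ?_)
      simpa [dist_eq_norm] using hlip.dist_le_mul (θ t ω) θ0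
    exact ((h1.add (memLp_const (prox θ0))).sub (hθL2 t ht)).ae_eq
      (Filter.Eventually.of_forall fun ω => by simp)
  have hsqint : ∀ t ≤ T, Integrable (fun ω => ‖θ t ω - prox (θ t ω)‖ ^ 2) P := fun t ht => by
    simpa only [norm_sub_rev] using (hdL2 t ht).integrable_norm_pow (p := 2) (by norm_num)
  have henvint : ∀ t ≤ T, Integrable (fun ω => envOn Θ f lam (θ t ω)) P := by
    intro t ht
    have hb : Integrable (fun ω => f θ0 + 1 / (2 * lam) * ‖θ0 - θ t ω‖ ^ 2) P := by
      refine (integrable_const _).add (Integrable.const_mul ?_ _)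
      exact ((memLp_const θ0).sub (hθL2 t ht)).integrable_norm_pow (p := 2) (by norm_num)
    refine integrable_of_le_of_le
      ((measurable_envOn hlam0 hFinf).comp (hθmeas t)).aestronglyMeasurable
      (Filter.Eventually.of_forall fun ω => le_envOn hne hlam0 hFinf _)
      (Filter.Eventually.of_forall fun ω => envOn_le hlam0 hFinf _ hθ0mem)
      (integrable_const Finf) hb
  have hstep : ∀ t < T, ∫ ω, envOn Θ f lam (θ (t + 1) ω) ∂P ≤ ∫ ω, envOn Θ f lam (θ t ω) ∂P
      - η / lam * ((1 / lam - κ) * ∫ ω, ‖θ t ω - prox (θ t ω)‖ ^ 2 ∂P)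
      + η ^ 2 / (2 * lam) * Gtot ^ 2 := by
    intro t ht
    have hm : MeasurableSpace.comap (θ t) inferInstance ≤ (inferInstance : MeasurableSpace Ω) :=
      (hθmeas t).comap_le
    have hθm : Measurable[MeasurableSpace.comap (θ t) inferInstance] (θ t) :=
      comap_measurable (θ t)
    have hd : StronglyMeasurable[MeasurableSpace.comap (θ t) inferInstance]
        (fun ω => prox (θ t ω) - θ t ω) :=
      ((hproxm.comp hθm).sub hθm).stronglyMeasurable
    have hinner : Integrable (fun ω => ⟪prox (θ t ω) - θ t ω, G t ω⟫) P :=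
      ((hdL2 t ht.le).norm.integrable_mul (hGL2 t).norm).mono'
        ((hdL2 t ht.le).aestronglyMeasurable.inner (hGL2 t).aestronglyMeasurable)
        (Filter.Eventually.of_forall fun ω => norm_inner_le_norm _ _)
    obtain ⟨hci, hce⟩ := integral_inner_condExp hm hd (hGint t) hinner
    have hG2 : ∫ ω, ‖G t ω‖ ^ 2 ∂P ≤ Gtot ^ 2 := by
      rw [← integral_condExp hm]
      calc _ ≤ ∫ _, Gtot ^ 2 ∂P :=
            integral_mono_ae integrable_condExp (integrable_const _) (hvar t ht)
        _ = Gtot ^ 2 := by simp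
    have hle : ∫ ω, ⟪prox (θ t ω) - θ t ω, G t ω⟫ ∂P
        ≤ -(1 / lam - κ) * ∫ ω, ‖θ t ω - prox (θ t ω)‖ ^ 2 ∂P := by
      rw [← hce, ← integral_const_mul]
      refine integral_mono_ae hci ((hsqint t ht.le).const_mul _) ?_
      filter_upwards [hmem t ht.le, hcond t ht] with ω h1 h2
      exact inner_prox_sub_le hsc hprox h1 h2
    have hlinint : Integrable (fun ω => envOn Θ f lam (θ t ω)
        + η / lam * ⟪prox (θ t ω) - θ t ω, G t ω⟫) P :=
      (henvint t ht.le).add (hinner.const_mul _)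
    calc ∫ ω, envOn Θ f lam (θ (t + 1) ω) ∂P
        ≤ ∫ ω, (envOn Θ f lam (θ t ω) + η / lam * ⟪prox (θ t ω) - θ t ω, G t ω⟫
            + η ^ 2 / (2 * lam) * ‖G t ω‖ ^ 2) ∂P := by
          refine integral_mono_ae (henvint _ ht)
            (hlinint.add ((hG2int t).const_mul _)) ?_
          filter_upwards [hupd t ht] with ω hω
          rw [hω]
          exact envOn_proj_step_le hconv hlam0 hFinf η (hprox _).1 (hprox _).2
            (hproj _).1 (hproj _).2
      _ = ∫ ω, envOn Θ f lam (θ t ω) ∂P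
            + η / lam * ∫ ω, ⟪prox (θ t ω) - θ t ω, G t ω⟫ ∂P
            + η ^ 2 / (2 * lam) * ∫ ω, ‖G t ω‖ ^ 2 ∂P := by
          rw [integral_add hlinint ((hG2int t).const_mul _),
            integral_add (henvint t ht.le) (hinner.const_mul _), integral_const_mul,
            integral_const_mul]
      _ ≤ ∫ ω, envOn Θ f lam (θ t ω) ∂P
            + η / lam * (-(1 / lam - κ) * ∫ ω, ‖θ t ω - prox (θ t ω)‖ ^ 2 ∂P)
            + η ^ 2 / (2 * lam) * Gtot ^ 2 := by gcongr
      _ = _ := by ring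
  have hgrad : ∀ t, ∫ ω, ‖(1 / lam) • (θ t ω - prox (θ t ω))‖ ^ 2 ∂P
      = (1 / lam) ^ 2 * ∫ ω, ‖θ t ω - prox (θ t ω)‖ ^ 2 ∂P := by
    intro t
    rw [← integral_const_mul]
    simp only [norm_smul, mul_pow, Real.norm_eq_abs, sq_abs]
  have hsum : ∀ N ≤ T, ∫ ω, envOn Θ f lam (θ N ω) ∂P
      + η * (1 - κ * lam) * ∑ t ∈ Finset.range N,
        ∫ ω, ‖(1 / lam) • (θ t ω - prox (θ t ω))‖ ^ 2 ∂P
      ≤ envOn Θ f lam θ0 + N * (η ^ 2 / (2 * lam) * Gtot ^ 2) := by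
    intro N
    induction N with
    | zero => intro _; simp [hθ0]
    | succ N ih =>
      intro hN
      have h1 := ih (by omega)
      have h2 := hstep N hN
      rw [Finset.sum_range_succ, hgrad N]
      have h3 : η * (1 - κ * lam) * ((1 / lam) ^ 2 * ∫ ω, ‖θ N ω - prox (θ N ω)‖ ^ 2 ∂P)
          = η / lam * ((1 / lam - κ) * ∫ ω, ‖θ N ω - prox (θ N ω)‖ ^ 2 ∂P) := by
        field_simp
      push_cast
      linarith
  have hTpos : (0 : ℝ) < T := by exact_mod_cast hT
  have hlast : Finf ≤ ∫ ω, envOn Θ f lam (θ T ω) ∂P := by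
    calc Finf = ∫ _, Finf ∂P := by simp
      _ ≤ _ := integral_mono (integrable_const _) (henvint T le_rfl)
        fun ω => le_envOn hne hlam0 hFinf _
  set S := ∑ t ∈ Finset.range T, ∫ ω, ‖(1 / lam) • (θ t ω - prox (θ t ω))‖ ^ 2 ∂P
  have hS : η * (1 - κ * lam) * S
      ≤ envOn Θ f lam θ0 - Finf + T * (η ^ 2 / (2 * lam) * Gtot ^ 2) := by
    linarith [hsum T le_rfl]
  have hlenv : 1 / lam ≤ 1 / (lam * (1 - κ * lam)) := by
    refine one_div_le_one_div_of_le (by positivity) ?_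
    nlinarith [mul_pos (mul_pos hκ hlam0) hlam0]
  calc (1 / (T : ℝ)) * S = η * (1 - κ * lam) * S / (η * (1 - κ * lam) * T) := by field_simp
    _ ≤ (envOn Θ f lam θ0 - Finf + T * (η ^ 2 / (2 * lam) * Gtot ^ 2))
          / (η * (1 - κ * lam) * T) := by gcongr
    _ = (envOn Θ f lam θ0 - Finf) / (η * (1 - κ * lam) * T)
          + 1 / lam * η * Gtot ^ 2 / (2 * (1 - κ * lam)) := by field_simp
    _ ≤ _ := by gcongr
end
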